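/- arXiv:2601.20764 — 3 statements merged into one kernel-verified Lean document; each statement's English description precedes it below -/
import Mathlib

section
/- In a finite cost game with exact potential Φ, there is no infinite sequence of strategy profiles s₀, s₁, s₂, … in which every consecutive pair sₙ, sₙ₊₁ is a unilateral improvement step (the finite improvement property). -/
/-- `Φ` is an exact potential for the cost game with cost functions `u`:
for every player `i`, profile `s`, and strategy `a : S i`,
`u i (update s i a) - u i s = Φ (update s i a) - Φ s`. -/
def ExactPotential {ι : Type*} [DecidableEq ι] {S : ι → Type*}
    (u : (i : ι) → ((j : ι) → S j) → ℝ) (Φ : ((j : ι) → S j) → ℝ) : Prop :=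
  ∀ (i : ι) (s : (j : ι) → S j) (a : S i),
    u i (Function.update s i a) - u i s = Φ (Function.update s i a) - Φ s

/-- A unilateral improvement step from `s` to `s'`: some player `i` switches to a
strategy `a` (`s' = update s i a`) and strictly decreases its own cost. -/
def ImprovementStep {ι : Type*} [DecidableEq ι] {S : ι → Type*}
    (u : (i : ι) → ((j : ι) → S j) → ℝ) (s s' : (j : ι) → S j) : Prop :=
  ∃ (i : ι) (a : S i), s' = Function.update s i a ∧ u i s' < u i s

/-- `s` is a Nash equilibrium of the cost game `u`: no player can strictly
decrease its own cost by a unilateral deviation. -/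
def NashEquilibrium {ι : Type*} [DecidableEq ι] {S : ι → Type*}
    (u : (i : ι) → ((j : ι) → S j) → ℝ) (s : (j : ι) → S j) : Prop :=
  ∀ (i : ι) (a : S i), u i s ≤ u i (Function.update s i a)

/-- An improvement step strictly decreases an exact potential. -/
theorem ExactPotential.lt_of_improvementStep {ι : Type*} [DecidableEq ι] {S : ι → Type*}
    {u : (i : ι) → ((j : ι) → S j) → ℝ} {Φ : ((j : ι) → S j) → ℝ}
    (hΦ : ExactPotential u Φ) {s s' : (j : ι) → S j} (h : ImprovementStep u s s') :
    Φ s' < Φ s := by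
  obtain ⟨i, a, rfl, hlt⟩ := h
  linarith [hΦ i s a]

/-- Finite improvement property: no infinite sequence of profiles in
which every consecutive pair is a unilateral improvement step. -/
theorem finite_improvement_property
    {ι : Type*} [Fintype ι] [Nonempty ι] [DecidableEq ι]
    {S : ι → Type*} [∀ i, Fintype (S i)] [∀ i, Nonempty (S i)]
    (u : (i : ι) → ((j : ι) → S j) → ℝ) (Φ : ((j : ι) → S j) → ℝ)
    (hΦ : ExactPotential u Φ) :
    ¬ ∃ s : ℕ → ((j : ι) → S j), ∀ n, ImprovementStep u (s n) (s (n + 1)) := by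
  rintro ⟨s, hs⟩
  have hanti : StrictAnti (Φ ∘ s) :=
    strictAnti_nat_of_succ_lt fun n => hΦ.lt_of_improvementStep (hs n)
  exact not_injective_infinite_finite s hanti.injective.of_comp
end

section
/- In a finite cost game with exact potential Φ, any strategy profile s that minimizes Φ over all profiles (Φ s ≤ Φ t for every profile t) is a Nash equilibrium; in particular, since the profile space is a finite nonempty set, a Nash equilibrium exists. -/
/-- Any global minimizer of the exact potential Φ is a Nash
equilibrium; in particular a Nash equilibrium exists. -/
theorem potential_minimizer_is_nash_and_nash_exists
    {ι : Type*} [Fintype ι] [Nonempty ι] [DecidableEq ι]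
    {S : ι → Type*} [∀ i, Fintype (S i)] [∀ i, Nonempty (S i)]
    (u : (i : ι) → ((j : ι) → S j) → ℝ) (Φ : ((j : ι) → S j) → ℝ)
    (hΦ : ExactPotential u Φ) :
    (∀ s : (j : ι) → S j, (∀ t : (j : ι) → S j, Φ s ≤ Φ t) → NashEquilibrium u s) ∧
      (∃ s : (j : ι) → S j, NashEquilibrium u s) := by
  have minimizer_nash (s : (j : ι) → S j) (hs : ∀ t : (j : ι) → S j, Φ s ≤ Φ t) :
      NashEquilibrium u s := fun i a ↦ by
    linarith [hΦ i s a, hs (Function.update s i a)]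
  obtain ⟨s, hs⟩ := Finite.exists_min Φ
  exact ⟨minimizer_nash, s, minimizer_nash s hs⟩
end

section
/- Let a finite cost game have exact potential Φ, let F be a set of players with fixed strategies f, and complete each partial profile t of the surviving players {i // i ∉ F} to ext t as above. Then there exists a partial profile t* that is a Nash equilibrium of the restricted game (for every surviving player i and every a ∈ S i, u i (ext t*) ≤ u i (ext (Function.update t* i a))) and that minimizes the restricted potential: Φ (ext t*) ≤ Φ (ext t) for every partial profile t. In particular, for any full profile s agreeing with f on F, the degradation Φ (ext t*) − (minimum of Φ over all full profiles) is at most Φ s − (minimum of Φ over all full profiles). -/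
/-- After permanently fixing the strategies of failed players F,
there is a partial profile of the survivors that is a Nash equilibrium of the
restricted game and minimizes the restricted potential; its degradation from the
global minimum of Φ is bounded by that of any full profile agreeing with the
failed players' fixed strategies. -/
theorem stability_under_failures
    {ι : Type*} [Fintype ι] [Nonempty ι] [DecidableEq ι]
    {S : ι → Type*} [∀ i, Fintype (S i)] [∀ i, Nonempty (S i)]
    (u : (i : ι) → ((j : ι) → S j) → ℝ) (Φ : ((j : ι) → S j) → ℝ)
    (hΦ : ExactPotential u Φ)
    (F : Set ι) [DecidablePred (· ∈ F)]
    (f : (j : ι) → j ∈ F → S j)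
    (ext : ((i : {i : ι // i ∉ F}) → S i.1) → ((j : ι) → S j))
    (hext : ∀ (t : (i : {i : ι // i ∉ F}) → S i.1) (j : ι),
      ext t j = if h : j ∈ F then f j h else t ⟨j, h⟩) :
    ∃ tstar : (i : {i : ι // i ∉ F}) → S i.1,
      (∀ (i : {i : ι // i ∉ F}) (a : S i.1),
        u i.1 (ext tstar) ≤ u i.1 (ext (Function.update tstar i a))) ∧
      (∀ t : (i : {i : ι // i ∉ F}) → S i.1, Φ (ext tstar) ≤ Φ (ext t)) ∧
      (∀ s : (j : ι) → S j, (∀ (j : ι) (h : j ∈ F), s j = f j h) →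
        Φ (ext tstar) - Finset.univ.inf' Finset.univ_nonempty Φ ≤
          Φ s - Finset.univ.inf' Finset.univ_nonempty Φ) := by
  obtain ⟨tstar, hmin⟩ := Finite.exists_min fun t => Φ (ext t)
  refine ⟨tstar, fun i a => ?_, hmin, fun s hs => ?_⟩
  · have hupdate : ext (Function.update tstar i a) = Function.update (ext tstar) i.1 a := by
      funext j
      by_cases hji : j = i.1
      · subst hji
        simp [hext, i.2]
      · by_cases hj : j ∈ F
        · simp [hext, hj, hji]
        · have hne : (⟨j, hj⟩ : {i : ι // i ∉ F}) ≠ i := fun h => hji (congrArg Subtype.val h)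
          simp [hext, hj, hji, hne]
    have hpot := hΦ i.1 (ext tstar) a
    have hle := hmin (Function.update tstar i a)
    rw [hupdate] at hle ⊢
    linarith
  · have hs_ext : ext (fun i => s i.1) = s := by
      funext j
      by_cases hj : j ∈ F <;> simp [hext, hj, hs]
    have hle := hmin fun i => s i.1
    rw [hs_ext] at hle
    exact sub_le_sub_right hle _
end
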